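/- arXiv:2102.07923 — 7 statements merged into one kernel-verified Lean document; each statement's English description precedes it below -/
import Mathlib

section
/- For all real numbers ψ, v_o, θ, φ, δ, α, β, γ and R with R ≠ 0 and cos v_o ≠ 0, define Θ = θ + φ, τ* = −β, k* = 1/R − γ, k_g* = (tan v_o)(cos φ)/R − α, and the angular velocities ω_x = δ(−cos Θ · τ* − sin Θ · k*), ω_y = δ(−sin Θ · τ* + sin Θ · k*), ω_z = −δ · k_g*. Then the 5-vector obtained by multiplying the Montana matrix M(ψ, v_o) = [[0, R, 0], [−R, 0, 0], [−sin ψ/cos v_o, −cos ψ/cos v_o, 0], [−cos ψ, sin ψ, 0], [−sin ψ tan v_o, −cos ψ tan v_o, −1]] by the column (ω_x, ω_y, ω_z) equals δ · (f(x) + γ·g₁(x) + β·g₂(x) + α·g₃(x)), where x = (u_s, v_s, u_o, v_o, ψ); i.e., substituting the Darboux-frame angular velocities into the Montana kinematic equations of the sphere rolling on a plane yields exactly the transformed Darboux-frame-based kinematic model. -/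
/-- Substituting the Darboux-frame angular velocities into the Montana kinematic
equations of the sphere rolling on a plane yields exactly the transformed
Darboux-frame-based kinematic model. Coordinates: x = (u_s, v_s, u_o, v_o, ψ). -/
theorem montana_darboux_transformation
    (ψ vo θ φ δ α β γ R : ℝ) (hR : R ≠ 0) (hv : Real.cos vo ≠ 0) :
    let Θ : ℝ := θ + φ
    let τs : ℝ := -β
    let ks : ℝ := 1 / R - γ
    let kgs : ℝ := Real.tan vo * Real.cos φ / R - α
    let ωx : ℝ := δ * (-Real.cos Θ * τs - Real.sin Θ * ks)
    let ωy : ℝ := δ * (-Real.sin Θ * τs + Real.sin Θ * ks)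
    let ωz : ℝ := -δ * kgs
    let M : Matrix (Fin 5) (Fin 3) ℝ :=
      !![0, R, 0;
         -R, 0, 0;
         -Real.sin ψ / Real.cos vo, -Real.cos ψ / Real.cos vo, 0;
         -Real.cos ψ, Real.sin ψ, 0;
         -Real.sin ψ * Real.tan vo, -Real.cos ψ * Real.tan vo, -1]
    let f : Fin 5 → ℝ :=
      ![Real.sin Θ, Real.sin Θ,
        Real.sin Θ * (Real.sin ψ - Real.cos ψ) / (R * Real.cos vo),
        Real.sin Θ * (Real.cos ψ + Real.sin ψ) / R,
        Real.tan vo * (Real.sin Θ * (Real.sin ψ - Real.cos ψ) + Real.cos φ) / R]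
    let g₁ : Fin 5 → ℝ :=
      ![-R * Real.sin Θ, -R * Real.sin Θ,
        Real.sin Θ * (Real.cos ψ - Real.sin ψ) / Real.cos vo,
        -(Real.sin Θ * (Real.sin ψ + Real.cos ψ)),
        Real.tan vo * (Real.sin Θ * (Real.cos ψ - Real.sin ψ))]
    let g₂ : Fin 5 → ℝ :=
      ![R * Real.sin Θ, -R * Real.cos Θ,
        -Real.sin (ψ + Θ) / Real.cos vo,
        -Real.cos (ψ + Θ),
        -Real.tan vo * Real.sin (ψ + Θ)]
    let g₃ : Fin 5 → ℝ := ![0, 0, 0, 0, -1]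
    M.mulVec ![ωx, ωy, ωz] = δ • (f + γ • g₁ + β • g₂ + α • g₃) := by
  intro Θ τs ks kgs ωx ωy ωz M f g₁ g₂ g₃
  have hs : Real.sin (ψ + Θ) = Real.sin ψ * Real.cos Θ + Real.cos ψ * Real.sin Θ :=
    Real.sin_add ψ Θ
  have hc : Real.cos (ψ + Θ) = Real.cos ψ * Real.cos Θ - Real.sin ψ * Real.sin Θ :=
    Real.cos_add ψ Θ
  simp only [M, f, g₁, g₂, g₃, ωx, ωy, ωz, τs, ks, kgs, hs, hc]
  clear_value Θ
  ext i
  fin_cases i <;>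
    simp [Matrix.mulVec, dotProduct, Fin.sum_univ_succ] <;> field_simp <;> ring
end

section
/- Let R ≠ 0, β ≠ 0, γ, α, G_f, θ, φ be real constants with Θ := θ + φ satisfying sin Θ ≠ 0 and the constraint cos Θ/sin Θ = (1/β)·((1/R)(1 − tan G_f) + γ(tan G_f − 1) − β tan G_f). Then at every point x = (u_s, v_s, u_o, v_o, ψ) with cos v_o ≠ 0, the second component of f(x) + γ·g₁(x) + β·g₂(x) + α·g₃(x) equals tan G_f times its first component. Consequently, every differentiable solution s ↦ x(s) of x' = f(x) + γ·g₁(x) + β·g₂(x) + α·g₃(x) keeps the quantity v_s(s) − tan G_f · u_s(s) constant, i.e., the contact point on the plane moves along the straight line of slope tan G_f through its initial position. -/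
/-- Proposition 1 of the paper: under the angular constraint on `Θ = θ + φ`, the plane
components of the Darboux-frame-based kinematics satisfy `v_s' = tan G_f · u_s'`, so every
solution of the kinematics keeps the contact point on the plane on the straight line of
slope `tan G_f` through its initial position. Coordinates: x = (u_s, v_s, u_o, v_o, ψ). -/
theorem plane_direction_kept
    (R β γ α Gf θ φ : ℝ) (hR : R ≠ 0) (hβ : β ≠ 0)
    (hΘ : Real.sin (θ + φ) ≠ 0)
    (hcon : Real.cos (θ + φ) / Real.sin (θ + φ) =
      (1 / β) * ((1 / R) * (1 - Real.tan Gf) + γ * (Real.tan Gf - 1)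
        - β * Real.tan Gf)) :
    let Θ : ℝ := θ + φ
    let F : (Fin 5 → ℝ) → Fin 5 → ℝ := fun x =>
      (![Real.sin Θ, Real.sin Θ,
          Real.sin Θ * (Real.sin (x 4) - Real.cos (x 4)) / (R * Real.cos (x 3)),
          Real.sin Θ * (Real.cos (x 4) + Real.sin (x 4)) / R,
          Real.tan (x 3) * (Real.sin Θ * (Real.sin (x 4) - Real.cos (x 4))
            + Real.cos φ) / R]
        + γ • ![-R * Real.sin Θ, -R * Real.sin Θ,
            Real.sin Θ * (Real.cos (x 4) - Real.sin (x 4)) / Real.cos (x 3),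
            -(Real.sin Θ * (Real.sin (x 4) + Real.cos (x 4))),
            Real.tan (x 3) * (Real.sin Θ * (Real.cos (x 4) - Real.sin (x 4)))]
        + β • ![R * Real.sin Θ, -R * Real.cos Θ,
            -Real.sin (x 4 + Θ) / Real.cos (x 3),
            -Real.cos (x 4 + Θ),
            -Real.tan (x 3) * Real.sin (x 4 + Θ)]
        + α • ![(0 : ℝ), 0, 0, 0, -1])
    (∀ x : Fin 5 → ℝ, Real.cos (x 3) ≠ 0 → F x 1 = Real.tan Gf * F x 0) ∧
    (∀ x : ℝ → Fin 5 → ℝ, (∀ s, Real.cos (x s 3) ≠ 0) →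
      (∀ s, ∀ i : Fin 5, HasDerivAt (fun t => x t i) (F (x s) i) s) →
      ∀ s t : ℝ, x s 1 - Real.tan Gf * x s 0 = x t 1 - Real.tan Gf * x t 0) := by
  intro Θ F
  have key : ∀ x : Fin 5 → ℝ, F x 1 = Real.tan Gf * F x 0 := by
    intro x
    have h : R * β * Real.cos (θ + φ) = Real.sin (θ + φ) * ((1 - Real.tan Gf)
        + R * γ * (Real.tan Gf - 1) - R * β * Real.tan Gf) := by
      generalize Real.tan Gf = T at hcon ⊢
      rw [div_eq_iff hΘ] at hcon
      rw [hcon]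
      field_simp
    simp only [F, Θ, Pi.add_apply, Pi.smul_apply, smul_eq_mul, Matrix.cons_val_zero,
      Matrix.cons_val_one]
    linear_combination -h
  refine ⟨fun x _ => key x, ?_⟩
  intro x _ hx s t
  have hd : ∀ r, HasDerivAt (fun t => x t 1 - Real.tan Gf * x t 0) 0 r := by
    intro r
    have h := (hx r 1).sub ((hx r 0).const_mul (Real.tan Gf))
    rw [key (x r), sub_self] at h
    exact h
  exact is_const_of_deriv_eq_zero (fun r => (hd r).differentiableAt) (fun r => (hd r).deriv) s t
end

section
/- Fix real constants θ, φ and R ≠ 0 and set Θ = θ + φ. At every point x = (u_s, v_s, u_o, v_o, ψ) with cos v_o ≠ 0, the divergence of the drift vector field f, i.e., the sum over i = 1,…,5 of the partial derivative of the i-th component of f with respect to the i-th coordinate, equals sin Θ · (sin ψ + cos ψ) · tan v_o / R. -/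
/-- The divergence of the drift vector field `f` of the Darboux-frame-based kinematics
equals `sin Θ (sin ψ + cos ψ) tan v_o / R`; this is the Liouville-theorem computation in
the controllability analysis. Coordinates: x = (u_s, v_s, u_o, v_o, ψ). -/
theorem drift_divergence (θ φ R : ℝ) (hR : R ≠ 0) :
    let Θ : ℝ := θ + φ
    let f : (Fin 5 → ℝ) → Fin 5 → ℝ := fun x =>
      ![Real.sin Θ, Real.sin Θ,
        Real.sin Θ * (Real.sin (x 4) - Real.cos (x 4)) / (R * Real.cos (x 3)),
        Real.sin Θ * (Real.cos (x 4) + Real.sin (x 4)) / R,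
        Real.tan (x 3) * (Real.sin Θ * (Real.sin (x 4) - Real.cos (x 4))
          + Real.cos φ) / R]
    ∀ x : Fin 5 → ℝ, Real.cos (x 3) ≠ 0 →
      (∑ i : Fin 5, fderiv ℝ (fun y => f y i) x (Pi.single i 1)) =
        Real.sin Θ * (Real.sin (x 4) + Real.cos (x 4)) * Real.tan (x 3) / R := by
  intro Θ f x hx
  have h3 : DifferentiableAt ℝ (fun y : Fin 5 → ℝ => y 3) x := by fun_prop
  have h4 : DifferentiableAt ℝ (fun y : Fin 5 → ℝ => y 4) x := by fun_prop
  have htan : DifferentiableAt ℝ (fun y : Fin 5 → ℝ => Real.tan (y 3)) x :=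
    DifferentiableAt.comp (g := Real.tan) (f := fun y : Fin 5 → ℝ => y 3) x
      (Real.differentiableAt_tan.2 hx) h3
  have hd2 : DifferentiableAt ℝ (fun y => f y 2) x := by
    change DifferentiableAt ℝ (fun y : Fin 5 → ℝ =>
      Real.sin Θ * (Real.sin (y 4) - Real.cos (y 4)) / (R * Real.cos (y 3))) x
    have hn : DifferentiableAt ℝ (fun y : Fin 5 → ℝ =>
      Real.sin Θ * (Real.sin (y 4) - Real.cos (y 4))) x := by fun_prop
    have hc : DifferentiableAt ℝ (fun y : Fin 5 → ℝ => R * Real.cos (y 3)) x := by fun_prop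
    have hne : (fun y : Fin 5 → ℝ => R * Real.cos (y 3)) x ≠ 0 := mul_ne_zero hR hx
    fun_prop (disch := exact hne)
  have hd3 : DifferentiableAt ℝ (fun y => f y 3) x := by
    change DifferentiableAt ℝ (fun y : Fin 5 → ℝ =>
      Real.sin Θ * (Real.cos (y 4) + Real.sin (y 4)) / R) x
    fun_prop
  have hd4 : DifferentiableAt ℝ (fun y => f y 4) x := by
    change DifferentiableAt ℝ (fun y : Fin 5 → ℝ =>
      Real.tan (y 3) * (Real.sin Θ * (Real.sin (y 4) - Real.cos (y 4)) + Real.cos φ) / R) x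
    have hn : DifferentiableAt ℝ (fun y : Fin 5 → ℝ =>
      Real.sin Θ * (Real.sin (y 4) - Real.cos (y 4)) + Real.cos φ) x := by fun_prop
    have hm := htan.fun_mul hn
    simp only [div_eq_mul_inv]
    exact hm.mul_const R⁻¹
  have e0 : fderiv ℝ (fun y => f y 0) x (Pi.single 0 1) = 0 := by
    change fderiv ℝ (fun _ : Fin 5 → ℝ => Real.sin Θ) x (Pi.single 0 1) = 0
    simp
  have e1 : fderiv ℝ (fun y => f y 1) x (Pi.single 1 1) = 0 := by
    change fderiv ℝ (fun _ : Fin 5 → ℝ => Real.sin Θ) x (Pi.single 1 1) = 0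
    simp
  have e2 : fderiv ℝ (fun y => f y 2) x (Pi.single 2 1) = 0 := by
    rw [← hd2.lineDeriv_eq_fderiv]
    simp [lineDeriv, f]
  have e3 : fderiv ℝ (fun y => f y 3) x (Pi.single 3 1) = 0 := by
    rw [← hd3.lineDeriv_eq_fderiv]
    simp [lineDeriv, f]
  have e4 : fderiv ℝ (fun y => f y 4) x (Pi.single 4 1) =
      Real.tan (x 3) * (Real.sin Θ * (Real.cos (x 4) + Real.sin (x 4))) / R := by
    rw [← hd4.lineDeriv_eq_fderiv]
    have hl : HasDerivAt (fun t : ℝ => x 4 + t) 1 0 := (hasDerivAt_id 0).const_add _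
    have key := (((((hl.sin.sub hl.cos).const_mul (Real.sin Θ)).add_const
      (Real.cos φ)).const_mul (Real.tan (x 3))).div_const R).deriv
    simp [lineDeriv, f] at key ⊢
    rw [key]
  rw [Fin.sum_univ_five, e0, e1, e2, e3, e4]
  ring
end

section
/- Fix real constants θ, φ and R ≠ 0 and set Θ = θ + φ. At every point x = (u_s, v_s, u_o, v_o, ψ) with cos v_o ≠ 0, the Lie bracket [f, g₃](x) := Df(x)(g₃(x)) − Dg₃(x)(f(x)) (where D denotes the Fréchet derivative and g₃ is the constant field (0,0,0,0,−1)) equals b₁(x) = (0, 0, −sin Θ(cos ψ + sin ψ)/(R cos v_o), −sin Θ(cos ψ − sin ψ)/R, −tan v_o sin Θ(cos ψ + sin ψ)/R). -/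
/-- The Lie bracket `[f, g₃](x) = Df(x)(g₃(x)) − Dg₃(x)(f(x))` of the drift `f` and the
spin-input field `g₃ = (0,0,0,0,−1)` equals the bracket field `b₁` used in the
controllability analysis. Coordinates: x = (u_s, v_s, u_o, v_o, ψ). -/
theorem bracket_f_g3 (θ φ R : ℝ) (hR : R ≠ 0) :
    let Θ : ℝ := θ + φ
    let f : (Fin 5 → ℝ) → Fin 5 → ℝ := fun x =>
      ![Real.sin Θ, Real.sin Θ,
        Real.sin Θ * (Real.sin (x 4) - Real.cos (x 4)) / (R * Real.cos (x 3)),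
        Real.sin Θ * (Real.cos (x 4) + Real.sin (x 4)) / R,
        Real.tan (x 3) * (Real.sin Θ * (Real.sin (x 4) - Real.cos (x 4))
          + Real.cos φ) / R]
    let g₃ : (Fin 5 → ℝ) → Fin 5 → ℝ := fun _ => ![0, 0, 0, 0, -1]
    let b₁ : (Fin 5 → ℝ) → Fin 5 → ℝ := fun x =>
      ![0, 0,
        -(Real.sin Θ * (Real.cos (x 4) + Real.sin (x 4))) / (R * Real.cos (x 3)),
        -(Real.sin Θ * (Real.cos (x 4) - Real.sin (x 4))) / R,
        -(Real.tan (x 3) * Real.sin Θ * (Real.cos (x 4) + Real.sin (x 4))) / R]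
    ∀ x : Fin 5 → ℝ, Real.cos (x 3) ≠ 0 →
      fderiv ℝ f x (g₃ x) - fderiv ℝ g₃ x (f x) = b₁ x := by
  intro Θ f g₃ b₁ x hx
  have hRc : R * Real.cos (x 3) ≠ 0 := mul_ne_zero hR hx
  have hd : DifferentiableAt ℝ f x := by
    rw [differentiableAt_pi]
    intro i
    have h4 : DifferentiableAt ℝ (fun y : Fin 5 → ℝ => y 4) x := by fun_prop
    have h3 : DifferentiableAt ℝ (fun y : Fin 5 → ℝ => y 3) x := by fun_prop
    have ht : DifferentiableAt ℝ (fun y : Fin 5 → ℝ => Real.tan (y 3)) x :=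
      DifferentiableAt.comp (g := Real.tan) (f := fun y : Fin 5 → ℝ => y 3) x
        (Real.differentiableAt_tan.2 hx) h3
    fin_cases i
    · exact differentiableAt_const _
    · exact differentiableAt_const _
    · have h := ((h4.sin.sub h4.cos).const_mul (Real.sin Θ)).fun_mul
        (DifferentiableAt.fun_inv (h3.cos.const_mul R) (by exact hRc))
      exact h
    · have h := ((h4.cos.add h4.sin).const_mul (Real.sin Θ)).mul_const R⁻¹
      exact h
    · have h := (ht.fun_mul (((h4.sin.sub h4.cos).const_mul (Real.sin Θ)).add_const
        (Real.cos φ))).mul_const R⁻¹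
      exact h
  have hg : fderiv ℝ g₃ x = 0 := fderiv_const_apply _
  have key : HasLineDerivAt ℝ f (b₁ x) x (g₃ x) := by
    unfold HasLineDerivAt
    rw [hasDerivAt_pi]
    have e3 : ∀ t : ℝ, (x + t • g₃ x) 3 = x 3 := fun t => by simp [g₃]
    have e4 : ∀ t : ℝ, (x + t • g₃ x) 4 = x 4 - t := fun t => by
      simp [g₃, sub_eq_add_neg]
    have h4 : HasDerivAt (fun t : ℝ => x 4 - t) (-1) 0 := by
      simpa using (hasDerivAt_id (0 : ℝ)).const_sub (x 4)
    have hs := h4.sin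
    have hc := h4.cos
    simp only [sub_zero] at hs hc
    intro i
    simp only [f, e3, e4]
    fin_cases i
    · exact hasDerivAt_const _ _
    · exact hasDerivAt_const _ _
    · refine (((hs.sub hc).const_mul (Real.sin Θ)).div_const (R * Real.cos (x 3))).congr_deriv ?_
      simp [b₁]; ring
    · refine (((hc.add hs).const_mul (Real.sin Θ)).div_const R).congr_deriv ?_
      simp [b₁]; ring
    · refine (((((hs.sub hc).const_mul (Real.sin Θ)).add_const (Real.cos φ)).const_mul
        (Real.tan (x 3))).div_const R).congr_deriv ?_
      simp [b₁]; ring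
  rw [hg, ← hd.lineDeriv_eq_fderiv, key.lineDeriv]
  simp
end

section
/- Fix real numbers θ, φ, ψ, v_o and R with R ≠ 0 and cos v_o ≠ 0, and set Θ = θ + φ. The 5×5 real matrix whose columns are g₁(x), g₂(x), g₃(x), b₁(x), b₂(x) (evaluated at x = (u_s, v_s, u_o, v_o, ψ)) is invertible if and only if sin Θ ≠ 0 and sin Θ + cos Θ ≠ 0. In particular, away from the singular configurations Θ ∈ {kπ} ∪ {kπ − π/4}, these five vectors form a basis of ℝ⁵, so the Lie algebra rank condition dim span{g₁, g₂, g₃, [f,g₃], [f,[f,g₃]]} = 5 holds. -/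
theorem larc_det_aux (a b c d e f g h i j p q r s t u : ℝ) :
    (Matrix.of ![![a,b,c,d,e],![f,g,h,i,j],![0,0,0,0,-1],![0,0,p,q,r],![0,0,s,t,u]] :
      Matrix (Fin 5) (Fin 5) ℝ).det = -((a * g - b * f) * (p * t - q * s)) := by
  simp [Matrix.det_succ_row_zero, Fin.sum_univ_succ, Fin.succAbove]
  ring

/-- LARC controllability test: the 5×5 matrix whose columns are
`g₁, g₂, g₃, b₁ = [f,g₃], b₂ = [f,[f,g₃]]` is invertible iff `sin Θ ≠ 0` and
`sin Θ + cos Θ ≠ 0`; away from these singularities the five vectors span ℝ⁵. -/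
theorem larc_rank_condition (θ φ ψ vo R : ℝ) (hR : R ≠ 0) (hv : Real.cos vo ≠ 0) :
    let Θ : ℝ := θ + φ
    let g₁ : Fin 5 → ℝ :=
      ![-R * Real.sin Θ, -R * Real.sin Θ,
        Real.sin Θ * (Real.cos ψ - Real.sin ψ) / Real.cos vo,
        -(Real.sin Θ * (Real.sin ψ + Real.cos ψ)),
        Real.tan vo * (Real.sin Θ * (Real.cos ψ - Real.sin ψ))]
    let g₂ : Fin 5 → ℝ :=
      ![R * Real.sin Θ, -R * Real.cos Θ,
        -Real.sin (ψ + Θ) / Real.cos vo,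
        -Real.cos (ψ + Θ),
        -Real.tan vo * Real.sin (ψ + Θ)]
    let g₃ : Fin 5 → ℝ := ![0, 0, 0, 0, -1]
    let b₁ : Fin 5 → ℝ :=
      ![0, 0,
        -(Real.sin Θ * (Real.cos ψ + Real.sin ψ)) / (R * Real.cos vo),
        -(Real.sin Θ * (Real.cos ψ - Real.sin ψ)) / R,
        -(Real.tan vo * Real.sin Θ * (Real.cos ψ + Real.sin ψ)) / R]
    let b₂ : Fin 5 → ℝ :=
      ![0, 0,
        Real.sin Θ * (Real.cos ψ - Real.sin ψ) / (R * Real.cos vo),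
        -(Real.sin Θ * (Real.cos ψ + Real.sin ψ)) / R,
        Real.tan vo * Real.sin Θ * (Real.cos ψ - Real.sin ψ) / R]
    let M : Matrix (Fin 5) (Fin 5) ℝ := (Matrix.of ![g₁, g₂, g₃, b₁, b₂]).transpose
    (IsUnit M ↔ (Real.sin Θ ≠ 0 ∧ Real.sin Θ + Real.cos Θ ≠ 0)) ∧
    (Real.sin Θ ≠ 0 → Real.sin Θ + Real.cos Θ ≠ 0 →
      Submodule.span ℝ ({g₁, g₂, g₃, b₁, b₂} : Set (Fin 5 → ℝ)) = ⊤) := by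
  intro Θ g₁ g₂ g₃ b₁ b₂ M
  have hdet : M.det = -(2 * Real.sin Θ ^ 3 * (Real.sin Θ + Real.cos Θ) / Real.cos vo) := by
    have hp := Real.sin_sq_add_cos_sq ψ
    rw [show M.det = _ from Matrix.det_transpose _]
    refine (larc_det_aux _ _ _ _ _ _ _ _ _ _ _ _ _ _ _ _).trans ?_
    generalize Real.sin Θ = S
    generalize Real.cos Θ = C
    have h2 : (2 : ℝ) = 2 * (Real.sin ψ ^ 2 + Real.cos ψ ^ 2) := by rw [hp]; ring
    rw [h2]
    field_simp
    ring
  have hiff : IsUnit M ↔ (Real.sin Θ ≠ 0 ∧ Real.sin Θ + Real.cos Θ ≠ 0) := by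
    rw [Matrix.isUnit_iff_isUnit_det, isUnit_iff_ne_zero, hdet]
    simp [hv]
  refine ⟨hiff, fun h1 h2 => ?_⟩
  have hu : IsUnit M := hiff.2 ⟨h1, h2⟩
  have hli : LinearIndependent ℝ M.col := Matrix.linearIndependent_cols_iff_isUnit.2 hu
  have hs := hli.span_eq_top_of_card_eq_finrank' (by simp)
  rw [← hs]
  congr 1
  change _ = Set.range ![g₁, g₂, g₃, b₁, b₂]
  simp only [Matrix.range_cons, Matrix.range_empty, Set.union_empty, Set.singleton_union]
end

section
/- Let θ, φ, α, γ : ℝ → ℝ be arbitrary functions, R ≠ 0, and let s ↦ x(s) = (u_s(s), v_s(s), u_o(s), v_o(s), ψ(s)) be a differentiable curve in ℝ⁵ with cos v_o(s) ≠ 0 for all s, satisfying the Darboux-frame-based kinematics with the input β_s identically zero: x'(s) = f(x(s)) + γ(s)·g₁(x(s)) + α(s)·g₃(x(s)), where at each s the fields f, g₁, g₃ are taken with parameters θ(s), φ(s). Then u_s'(s) = v_s'(s) for all s; hence u_s(s) − v_s(s) is constant along the motion, so the system cannot reach any plane configuration with a different value of u_s − v_s (the model is not controllable without the input β_s). -/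
/-- Drift vector field of the Darboux-frame-based kinematics of a spin-rolling sphere of
radius `R` on a plane, with parameters `θ`, `φ`. Coordinates: x = (u_s, v_s, u_o, v_o, ψ). -/
noncomputable def darbouxDrift (θ φ R : ℝ) (x : Fin 5 → ℝ) : Fin 5 → ℝ :=
  ![Real.sin (θ + φ), Real.sin (θ + φ),
    Real.sin (θ + φ) * (Real.sin (x 4) - Real.cos (x 4)) / (R * Real.cos (x 3)),
    Real.sin (θ + φ) * (Real.cos (x 4) + Real.sin (x 4)) / R,
    Real.tan (x 3) * (Real.sin (θ + φ) * (Real.sin (x 4) - Real.cos (x 4))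
      + Real.cos φ) / R]

/-- Input vector field of the input `γ_s` of the Darboux-frame-based kinematics. -/
noncomputable def darbouxG1 (θ φ R : ℝ) (x : Fin 5 → ℝ) : Fin 5 → ℝ :=
  ![-R * Real.sin (θ + φ), -R * Real.sin (θ + φ),
    Real.sin (θ + φ) * (Real.cos (x 4) - Real.sin (x 4)) / Real.cos (x 3),
    -(Real.sin (θ + φ) * (Real.sin (x 4) + Real.cos (x 4))),
    Real.tan (x 3) * (Real.sin (θ + φ) * (Real.cos (x 4) - Real.sin (x 4)))]

/-- Input vector field of the spin input `α_s` of the Darboux-frame-based kinematics. -/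
def darbouxG3 : Fin 5 → ℝ := ![0, 0, 0, 0, -1]

/-- Proposition 2 of the paper: with the input `β_s` identically zero, any solution of
the Darboux-frame-based kinematics (with arbitrary, possibly time-varying parameters
`θ, φ` and inputs `γ, α`) satisfies `u_s' = v_s'`, hence `u_s − v_s` stays constant and
the model is not controllable without the input `β_s`. -/
theorem not_controllable_without_beta
    (θ φ α γ : ℝ → ℝ) (R : ℝ) (hR : R ≠ 0) (x : ℝ → Fin 5 → ℝ)
    (hx : Differentiable ℝ x)
    (hcos : ∀ s, Real.cos (x s 3) ≠ 0)
    (hode : ∀ s : ℝ, ∀ i : Fin 5, HasDerivAt (fun t => x t i)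
      ((darbouxDrift (θ s) (φ s) R (x s) + γ s • darbouxG1 (θ s) (φ s) R (x s)
        + α s • darbouxG3) i) s) :
    (∀ s : ℝ, deriv (fun t => x t 0) s = deriv (fun t => x t 1) s) ∧
    (∀ s t : ℝ, x s 0 - x s 1 = x t 0 - x t 1) := by
  have key : ∀ s : ℝ, deriv (fun t => x t 0) s = deriv (fun t => x t 1) s := by
    intro s
    rw [(hode s 0).deriv, (hode s 1).deriv]
    simp [darbouxDrift, darbouxG1, darbouxG3]
  refine ⟨key, fun s t => ?_⟩
  have hd : Differentiable ℝ (fun t => x t 0 - x t 1) := fun r =>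
    ((hode r 0).sub (hode r 1)).differentiableAt
  refine is_const_of_deriv_eq_zero hd (fun r => ?_) s t
  have h := ((hode r 0).sub (hode r 1)).deriv
  rw [← (hode r 0).deriv, ← (hode r 1).deriv, key r, sub_self] at h
  exact h
end

section
/- Let k_g^o, k_n^o, τ_g^o, k_g^v, k_n^v, τ_g^v : ℝ → ℝ, let e₁, e₂, e₃ : ℝ → ℝ³ be differentiable maps satisfying the Darboux frame equations with the curvatures of the virtual surface: e₁' = k_g^v·e₂ + k_n^v·e₃, e₂' = −k_g^v·e₁ + τ_g^v·e₃, e₃' = −k_n^v·e₁ − τ_g^v·e₂, and let P : ℝ → ℝ³ be differentiable with P' = e₁. Let σ₁, σ₂, σ₃ : ℝ → ℝ be differentiable and satisfy the body-fixed-point equations with the curvatures of the rolling object: σ₁' = σ₂·k_g^o + σ₃·k_n^o − 1, σ₂' = −σ₁·k_g^o + σ₃·τ_g^o, σ₃' = −σ₁·k_n^o − σ₂·τ_g^o. Then, writing Δk_g = k_g^o − k_g^v, Δk_n = k_n^o − k_n^v, Δτ = τ_g^o − τ_g^v, the map M := P + σ₁·e₁ + σ₂·e₂ + σ₃·e₃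 satisfies M' = (σ₂·Δk_g + σ₃·Δk_n)·e₁ + (−σ₁·Δk_g + σ₃·Δτ)·e₂ + (−σ₁·Δk_n − σ₂·Δτ)·e₃. -/
/-- Relative-curvature lemma (Appendix B of the paper): if the common Darboux frame
`(e₁, e₂, e₃)` at the contact point `P` evolves with the curvatures of the virtual
surface, while the body-fixed-point coordinates `(σ₁, σ₂, σ₃)` evolve with the
curvatures of the rolling object, then the point `M = P + σ₁e₁ + σ₂e₂ + σ₃e₃` moves
according to the relative curvatures `Δk_g, Δk_n, Δτ`. -/
theorem relative_curvature_motion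
    (kgo kno τgo kgv knv τgv : ℝ → ℝ)
    (e₁ e₂ e₃ P : ℝ → EuclideanSpace ℝ (Fin 3))
    (σ₁ σ₂ σ₃ : ℝ → ℝ)
    (he₁ : ∀ s : ℝ, HasDerivAt e₁ (kgv s • e₂ s + knv s • e₃ s) s)
    (he₂ : ∀ s : ℝ, HasDerivAt e₂ (-(kgv s) • e₁ s + τgv s • e₃ s) s)
    (he₃ : ∀ s : ℝ, HasDerivAt e₃ (-(knv s) • e₁ s - τgv s • e₂ s) s)
    (hP : ∀ s : ℝ, HasDerivAt P (e₁ s) s)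
    (hσ₁ : ∀ s : ℝ, HasDerivAt σ₁ (σ₂ s * kgo s + σ₃ s * kno s - 1) s)
    (hσ₂ : ∀ s : ℝ, HasDerivAt σ₂ (-(σ₁ s) * kgo s + σ₃ s * τgo s) s)
    (hσ₃ : ∀ s : ℝ, HasDerivAt σ₃ (-(σ₁ s) * kno s - σ₂ s * τgo s) s) :
    ∀ s : ℝ, HasDerivAt (fun t => P t + σ₁ t • e₁ t + σ₂ t • e₂ t + σ₃ t • e₃ t)
      ((σ₂ s * (kgo s - kgv s) + σ₃ s * (kno s - knv s)) • e₁ s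
        + (-(σ₁ s) * (kgo s - kgv s) + σ₃ s * (τgo s - τgv s)) • e₂ s
        + (-(σ₁ s) * (kno s - knv s) - σ₂ s * (τgo s - τgv s)) • e₃ s) s := by
  intro s
  have h := (((hP s).add ((hσ₁ s).smul (he₁ s))).add ((hσ₂ s).smul (he₂ s))).add
    ((hσ₃ s).smul (he₃ s))
  refine h.congr_deriv ?_
  module
end
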